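/- Let n ≥ 1, let p⃗, s⃗ be n-tuples with 1 ≤ pᵢ, sᵢ ≤ ∞ and let 1 ≤ α ≤ ∞ satisfy (1/n)Σᵢ 1/sᵢ ≤ 1/α ≤ (1/n)Σᵢ 1/pᵢ. Then the continuous and discrete mixed-norm amalgam norms are equivalent, with constants independent of f: ‖f‖_{(L^{p⃗},L^{s⃗})} ∼ ‖f‖_{p⃗,s⃗} and ‖f‖_{(L^{p⃗},L^{s⃗})^α} ∼ ‖f‖_{p⃗,s⃗,α} for all locally integrable f; consequently (L^{p⃗},L^{s⃗})(ℝⁿ) = (L^{p⃗},ℓ^{s⃗})(ℝⁿ) and (L^{p⃗},L^{s⃗})^α(ℝⁿ) = (L^{p⃗},ℓ^{s⃗})^α(ℝⁿ) as sets. -/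

import Mathlib

open MeasureTheory ENNReal Filter Topology Set

noncomputable section

namespace MixedAmalgam

/-- `L^p` norm over `ℝ` of an `ℝ≥0∞`-valued function, with the usual
modification (`essSup`) for `p = ∞`. -/
def lpInt (p : ℝ≥0∞) (g : ℝ → ℝ≥0∞) : ℝ≥0∞ :=
  if p = ∞ then essSup g volume else (∫⁻ t, g t ^ p.toReal) ^ (1 / p.toReal)

/-- `ℓ^p` norm over `ℤ` of an `ℝ≥0∞`-valued family, with the usual
modification for `p = ∞`. -/
def lpSum (p : ℝ≥0∞) (g : ℤ → ℝ≥0∞) : ℝ≥0∞ :=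
  if p = ∞ then ⨆ k, g k else (∑' k, g k ^ p.toReal) ^ (1 / p.toReal)

/-- Iterated mixed Lebesgue norm of an `ℝ≥0∞`-valued function on `ℝⁿ`,
taking the `L^{p₁}` norm in the first variable innermost, and the `L^{pₙ}`
norm in the last variable outermost. -/
def mixedE : (n : ℕ) → (Fin n → ℝ≥0∞) → ((Fin n → ℝ) → ℝ≥0∞) → ℝ≥0∞
  | 0, _, g => g Fin.elim0
  | n + 1, p, g =>
    lpInt (p (Fin.last n)) fun t =>
      mixedE n (fun i => p i.castSucc) fun x => g (Fin.snoc x t)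

/-- Mixed-norm Lebesgue norm `‖f‖_{L^{p⃗}}` of a real-valued function on `ℝⁿ`. -/
def mixedLp (n : ℕ) (p : Fin n → ℝ≥0∞) (f : (Fin n → ℝ) → ℝ) : ℝ≥0∞ :=
  mixedE n p fun x => (‖f x‖₊ : ℝ≥0∞)

/-- Iterated mixed `ℓ^{s⃗}` norm of an `ℝ≥0∞`-valued family indexed by `ℤⁿ`. -/
def mixedSeq : (n : ℕ) → (Fin n → ℝ≥0∞) → ((Fin n → ℤ) → ℝ≥0∞) → ℝ≥0∞
  | 0, _, a => a Fin.elim0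
  | n + 1, s, a =>
    lpSum (s (Fin.last n)) fun k =>
      mixedSeq n (fun i => s i.castSucc) fun m => a (Fin.snoc m k)

/-- Open Euclidean ball of center `y` and radius `r` in `ℝⁿ`. -/
def eball (n : ℕ) (y : Fin n → ℝ) (r : ℝ) : Set (Fin n → ℝ) :=
  {x | Real.sqrt (∑ i, (x i - y i) ^ 2) < r}

/-- `Σᵢ 1/pᵢ` as a real number. -/
def invSum (n : ℕ) (p : Fin n → ℝ≥0∞) : ℝ :=
  ∑ i, (1 / p i).toReal

/-- The `(L^{p⃗},L^{s⃗})` amalgam norm computed with balls of radius `r`. -/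
def amalgamNormR (n : ℕ) (p s : Fin n → ℝ≥0∞) (r : ℝ) (f : (Fin n → ℝ) → ℝ) : ℝ≥0∞ :=
  mixedE n s fun y => mixedLp n p ((eball n y r).indicator f)

/-- The amalgam norm `‖f‖_{(L^{p⃗},L^{s⃗})}`. -/
def amalgamNorm (n : ℕ) (p s : Fin n → ℝ≥0∞) (f : (Fin n → ℝ) → ℝ) : ℝ≥0∞ :=
  amalgamNormR n p s 1 f

/-- The amalgam norm `‖f‖_{(L^{p⃗},L^{s⃗})^α}`. -/
def amalgamNormA (n : ℕ) (p s : Fin n → ℝ≥0∞) (α : ℝ≥0∞) (f : (Fin n → ℝ) → ℝ) : ℝ≥0∞ :=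
  ⨆ (r : ℝ) (_ : 0 < r),
    mixedE n s fun y =>
      volume (eball n y r) ^
          ((1 / α).toReal - invSum n p / (n : ℝ) - invSum n s / (n : ℝ)) *
        mixedLp n p ((eball n y r).indicator f)

/-- The amalgam norm `‖·‖_{(L^{p⃗},L^{s⃗})^α}` for `ℝ≥0∞`-valued functions. -/
def amalgamNormAE (n : ℕ) (p s : Fin n → ℝ≥0∞) (α : ℝ≥0∞)
    (g : (Fin n → ℝ) → ℝ≥0∞) : ℝ≥0∞ :=
  ⨆ (r : ℝ) (_ : 0 < r),
    mixedE n s fun y =>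
      volume (eball n y r) ^
          ((1 / α).toReal - invSum n p / (n : ℝ) - invSum n s / (n : ℝ)) *
        mixedE n p ((eball n y r).indicator g)

/-- The cube `Q_{r,k} = r(k + [0,1)ⁿ)`. -/
def qcube (n : ℕ) (r : ℝ) (k : Fin n → ℤ) : Set (Fin n → ℝ) :=
  {x | ∀ i, r * (k i : ℝ) ≤ x i ∧ x i < r * ((k i : ℝ) + 1)}

/-- The discrete amalgam norm `_r‖f‖_{p⃗,s⃗}`. -/
def discNormR (n : ℕ) (p s : Fin n → ℝ≥0∞) (r : ℝ) (f : (Fin n → ℝ) → ℝ) : ℝ≥0∞ :=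
  mixedSeq n s fun k => mixedLp n p ((qcube n r k).indicator f)

/-- The discrete amalgam norm `‖f‖_{p⃗,s⃗} = _1‖f‖_{p⃗,s⃗}`. -/
def discNorm (n : ℕ) (p s : Fin n → ℝ≥0∞) (f : (Fin n → ℝ) → ℝ) : ℝ≥0∞ :=
  discNormR n p s 1 f

/-- The discrete amalgam norm
`‖f‖_{p⃗,s⃗,α} = sup_{r>0} r^{n/α - Σᵢ 1/pᵢ} · _r‖f‖_{p⃗,s⃗}`. -/
def discNormA (n : ℕ) (p s : Fin n → ℝ≥0∞) (α : ℝ≥0∞) (f : (Fin n → ℝ) → ℝ) : ℝ≥0∞ :=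
  ⨆ (r : ℝ) (_ : 0 < r),
    ENNReal.ofReal (r ^ ((n : ℝ) * (1 / α).toReal - invSum n p)) * discNormR n p s r f

/-- Membership in `(L^{p⃗},L^{s⃗})^α(ℝⁿ)` (continuous form). -/
def memA (n : ℕ) (p s : Fin n → ℝ≥0∞) (α : ℝ≥0∞) (f : (Fin n → ℝ) → ℝ) : Prop :=
  LocallyIntegrable f volume ∧ amalgamNormA n p s α f < ∞

/-- Membership in `(L^{p⃗},ℓ^{s⃗})(ℝⁿ)`. -/
def memD (n : ℕ) (p s : Fin n → ℝ≥0∞) (f : (Fin n → ℝ) → ℝ) : Prop :=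
  LocallyIntegrable f volume ∧ discNorm n p s f < ∞

/-- Membership in `(L^{p⃗},ℓ^{s⃗})^α(ℝⁿ)`. -/
def memDA (n : ℕ) (p s : Fin n → ℝ≥0∞) (α : ℝ≥0∞) (f : (Fin n → ℝ) → ℝ) : Prop :=
  LocallyIntegrable f volume ∧ discNormA n p s α f < ∞

/-- The dilation `St_r^{(α)} f = r^{-n/α} f(r⁻¹ ·)`. -/
def dil (n : ℕ) (α : ℝ≥0∞) (r : ℝ) (f : (Fin n → ℝ) → ℝ) : (Fin n → ℝ) → ℝ :=
  fun x => r ^ (-((n : ℝ) * (1 / α).toReal)) * f (r⁻¹ • x)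

/-- A block decomposition `f = Σ_j c_j St_{r_j}^{(α')} f_j` converging in `L¹_loc`. -/
structure BlockDecomp (n : ℕ) (p' s' : Fin n → ℝ≥0∞) (α' : ℝ≥0∞) (f : (Fin n → ℝ) → ℝ)
    (c : ℕ → ℝ) (rr : ℕ → ℝ) (g : ℕ → (Fin n → ℝ) → ℝ) : Prop where
  csummable : Summable fun j => |c j|
  rpos : ∀ j, 0 < rr j
  gloc : ∀ j, LocallyIntegrable (g j) volume
  gnorm : ∀ j, discNorm n p' s' (g j) ≤ 1
  conv : ∀ K : Set (Fin n → ℝ), IsCompact K →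
    Tendsto (fun J : ℕ =>
        ∫⁻ x in K,
          (‖f x - ∑ j ∈ Finset.range J, c j * dil n α' (rr j) (g j) x‖₊ : ℝ≥0∞))
      atTop (𝓝 0)

/-- Membership in the block space `H(p⃗',s⃗',α')`. -/
def memH (n : ℕ) (p' s' : Fin n → ℝ≥0∞) (α' : ℝ≥0∞) (f : (Fin n → ℝ) → ℝ) : Prop :=
  LocallyIntegrable f volume ∧ ∃ c rr g, BlockDecomp n p' s' α' f c rr g

/-- The norm of the block space `H(p⃗',s⃗',α')`. -/
def hNorm (n : ℕ) (p' s' : Fin n → ℝ≥0∞) (α' : ℝ≥0∞) (f : (Fin n → ℝ) → ℝ) : ℝ≥0∞ :=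
  ⨅ (c : ℕ → ℝ) (rr : ℕ → ℝ) (g : ℕ → (Fin n → ℝ) → ℝ)
    (_ : BlockDecomp n p' s' α' f c rr g), ENNReal.ofReal (∑' j, |c j|)

/-- The fractional integral operator `I_γ`. -/
def fracInt (n : ℕ) (γ : ℝ) (f : (Fin n → ℝ) → ℝ) : (Fin n → ℝ) → ℝ :=
  fun x => ∫ y, f y / Real.sqrt (∑ i, (x i - y i) ^ 2) ^ ((n : ℝ) - γ)

/-- The fractional maximal operator `M_γ`. -/
def fracMax (n : ℕ) (γ : ℝ) (f : (Fin n → ℝ) → ℝ) : (Fin n → ℝ) → ℝ≥0∞ :=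
  fun x => ⨆ (y : Fin n → ℝ) (r : ℝ) (_ : 0 < r) (_ : x ∈ eball n y r),
    volume (eball n y r) ^ (γ / (n : ℝ) - 1) * ∫⁻ z in eball n y r, (‖f z‖₊ : ℝ≥0∞)

/-- The commutator `[b, I_γ] f`. -/
def commFracInt (n : ℕ) (γ : ℝ) (b f : (Fin n → ℝ) → ℝ) : (Fin n → ℝ) → ℝ :=
  fun x => ∫ y, (b x - b y) * f y / Real.sqrt (∑ i, (x i - y i) ^ 2) ^ ((n : ℝ) - γ)

/-- The mean value `b_B` of `b` over the ball `B(y,r)`. -/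
def ballAvg (n : ℕ) (b : (Fin n → ℝ) → ℝ) (y : Fin n → ℝ) (r : ℝ) : ℝ :=
  (volume (eball n y r)).toReal⁻¹ * ∫ x in eball n y r, b x

/-- The `BMO` norm `sup_B (1/|B|) ∫_B |b - b_B|`. -/
def bmoNorm (n : ℕ) (b : (Fin n → ℝ) → ℝ) : ℝ≥0∞ :=
  ⨆ (y : Fin n → ℝ) (r : ℝ) (_ : 0 < r),
    ENNReal.ofReal
      ((volume (eball n y r)).toReal⁻¹ * ∫ x in eball n y r, |b x - ballAvg n b y r|)

/-- Iterated mixed norm over a general measure space. -/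
def mixG {X : Type} [MeasurableSpace X] (μ : Measure X) :
    (n : ℕ) → (Fin n → ℝ≥0∞) → ((Fin n → X) → ℝ≥0∞) → ℝ≥0∞
  | 0, _, g => g Fin.elim0
  | n + 1, p, g =>
    eLpNorm (fun t => mixG μ n (fun i => p i.castSucc) fun x => g (Fin.snoc x t))
      (p (Fin.last n)) μ

theorem lpInt_eq (p : ℝ≥0∞) (hp : p ≠ 0) (g : ℝ → ℝ≥0∞) :
    lpInt p g = eLpNorm g p volume := by
  unfold lpInt
  split_ifs with h
  · subst h; simp [eLpNormEssSup]
  · rw [eLpNorm_eq_lintegral_rpow_enorm_toReal hp h]; simp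

theorem lpSum_eq (p : ℝ≥0∞) (hp : p ≠ 0) (g : ℤ → ℝ≥0∞) :
    lpSum p g = eLpNorm g p Measure.count := by
  unfold lpSum
  split_ifs with h
  · subst h; simp [eLpNormEssSup]
  · rw [eLpNorm_eq_lintegral_rpow_enorm_toReal hp h, lintegral_count]; simp

theorem mixedE_eq (n : ℕ) (p : Fin n → ℝ≥0∞) (hp : ∀ i, p i ≠ 0) (g : (Fin n → ℝ) → ℝ≥0∞) :
    mixedE n p g = mixG volume n p g := by
  induction n with
  | zero => rfl
  | succ n ih =>
    simp only [mixedE, mixG]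
    rw [lpInt_eq _ (hp _)]
    congr 1; funext t
    exact ih _ (fun i => hp _) _

theorem mixedSeq_eq (n : ℕ) (p : Fin n → ℝ≥0∞) (hp : ∀ i, p i ≠ 0) (g : (Fin n → ℤ) → ℝ≥0∞) :
    mixedSeq n p g = mixG Measure.count n p g := by
  induction n with
  | zero => rfl
  | succ n ih =>
    simp only [mixedSeq, mixG]
    rw [lpSum_eq _ (hp _)]
    congr 1; funext t
    exact ih _ (fun i => hp _) _

section general
variable {X : Type} [MeasurableSpace X] (μ : Measure X)

theorem mixG_mono (n : ℕ) (p : Fin n → ℝ≥0∞) {g h : (Fin n → X) → ℝ≥0∞} (hgh : ∀ x, g x ≤ h x) :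
    mixG μ n p g ≤ mixG μ n p h := by
  induction n with
  | zero => exact hgh _
  | succ n ih =>
    simp only [mixG]
    apply eLpNorm_mono_enorm
    intro t
    exact ih _ (fun x => hgh _)

theorem eLpNorm_cmul (c : ℝ≥0∞) (hc : c ≠ ∞) (p : ℝ≥0∞) (g : X → ℝ≥0∞) :
    eLpNorm (fun x => c * g x) p μ = c * eLpNorm g p μ := by
  by_cases h0 : p = 0
  · subst h0; simp
  by_cases h : p = ∞
  · subst h; simp [eLpNormEssSup, ENNReal.essSup_const_mul]
  · rw [eLpNorm_eq_lintegral_rpow_enorm_toReal h0 h, eLpNorm_eq_lintegral_rpow_enorm_toReal h0 h]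
    have hp : 0 < p.toReal := ENNReal.toReal_pos h0 h
    simp only [enorm_eq_self]
    simp_rw [ENNReal.mul_rpow_of_nonneg _ _ hp.le]
    rw [lintegral_const_mul' _ _ (ENNReal.rpow_ne_top_of_nonneg hp.le hc),
      ENNReal.mul_rpow_of_nonneg _ _ (by positivity), ← ENNReal.rpow_mul]
    rw [mul_one_div_cancel hp.ne', ENNReal.rpow_one]

theorem mixG_cmul (n : ℕ) (p : Fin n → ℝ≥0∞) (c : ℝ≥0∞) (hc : c ≠ ∞) (g : (Fin n → X) → ℝ≥0∞) :
    mixG μ n p (fun x => c * g x) = c * mixG μ n p g := by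
  induction n with
  | zero => rfl
  | succ n ih =>
    simp only [mixG]
    simp_rw [ih]
    exact eLpNorm_cmul μ c hc _ _

theorem mixG_zero (n : ℕ) (p : Fin n → ℝ≥0∞) :
    mixG μ n p (fun _ => 0) = 0 := by
  simpa using mixG_cmul μ n p 0 (by simp) (fun _ => 0)

theorem mixG_smul (n : ℕ) (p : Fin n → ℝ≥0∞) (c : ℝ≥0∞) (hc0 : c ≠ 0) (hc : c ≠ ∞)
    (g : (Fin n → X) → ℝ≥0∞) :
    mixG (c • μ) n p g = c ^ (invSum n p) * mixG μ n p g := by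
  induction n with
  | zero => simp [mixG, invSum]
  | succ n ih =>
    simp only [mixG]
    simp_rw [ih]
    rw [eLpNorm_cmul _ _ (ENNReal.rpow_ne_top_of_ne_zero hc0 hc),
      eLpNorm_smul_measure_of_ne_zero hc0, smul_eq_mul, ← mul_assoc,
      ← ENNReal.rpow_add _ _ hc0 hc]
    congr 2
    simp [invSum, Fin.sum_univ_castSucc]

theorem measurable_eLpNorm [SFinite μ] {Y : Type} [MeasurableSpace Y] (p : ℝ≥0∞)
    (g : Y → X → ℝ≥0∞) (hg : Measurable (Function.uncurry g)) :
    Measurable (fun y => eLpNorm (g y) p μ) := by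
  by_cases h0 : p = 0
  · subst h0; simp
  by_cases h : p = ∞
  · subst h
    simp only [eLpNorm_exponent_top, eLpNormEssSup, enorm_eq_self]
    apply measurable_of_Iic
    intro c
    have : (fun y => essSup (g y) μ) ⁻¹' Iic c
        = (fun y => μ (Prod.mk y ⁻¹' {z : Y × X | c < Function.uncurry g z})) ⁻¹' {0} := by
      ext y
      simp only [mem_preimage, mem_Iic, mem_singleton_iff]
      constructor
      · intro hy
        have := (ENNReal.ae_le_essSup (μ := μ) (g y))
        have h2 : ∀ᵐ x ∂μ, g y x ≤ c := this.mono fun x hx => hx.trans hy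
        rw [ae_iff] at h2
        simpa using h2
      · intro hy
        refine essSup_le_of_ae_le _ ?_
        change ∀ᵐ x ∂μ, g y x ≤ c
        rw [ae_iff]
        simpa using hy
    rw [this]
    exact measurable_measure_prodMk_left (measurableSet_lt measurable_const hg)
      (measurableSet_singleton 0)
  · simp_rw [eLpNorm_eq_lintegral_rpow_enorm_toReal h0 h, enorm_eq_self]
    apply Measurable.pow_const
    exact Measurable.lintegral_prod_right' (f := fun z : Y × X => Function.uncurry g z ^ p.toReal)
      (hg.pow_const _)

theorem measurable_snoc (n : ℕ) :
    Measurable (fun z : (Fin n → X) × X => (Fin.snoc z.1 z.2 : Fin (n + 1) → X)) := by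
  rw [measurable_pi_iff]
  intro i
  refine Fin.lastCases ?_ (fun i => ?_) i
  · simpa using measurable_snd
  · simp only [Fin.snoc_castSucc]
    exact (measurable_pi_apply i).comp measurable_fst

theorem measurable_mixG [SFinite μ] (n : ℕ) (p : Fin n → ℝ≥0∞) {Y : Type} [MeasurableSpace Y]
    (g : Y → (Fin n → X) → ℝ≥0∞) (hg : Measurable (Function.uncurry g)) :
    Measurable (fun y => mixG μ n p (g y)) := by
  induction n generalizing Y with
  | zero =>
    simp only [mixG]
    exact hg.comp (measurable_id.prodMk measurable_const)
  | succ n ih =>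
    simp only [mixG]
    apply measurable_eLpNorm μ _
      (fun y t => mixG μ n (fun i => p i.castSucc) fun x => g y (Fin.snoc x t))
    apply ih (fun i => p i.castSucc) (fun (z : Y × X) x => g z.1 (Fin.snoc x z.2))
    have : Measurable (fun w : (Y × X) × (Fin n → X) =>
        ((w.1.1, Fin.snoc w.2 w.1.2) : Y × (Fin (n + 1) → X))) :=
      (measurable_fst.comp measurable_fst).prodMk
        ((measurable_snoc n).comp (measurable_snd.prodMk (measurable_snd.comp measurable_fst)))
    exact hg.comp this

theorem mixG_add [SFinite μ] (n : ℕ) (p : Fin n → ℝ≥0∞) (hp : ∀ i, 1 ≤ p i)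
    (g h : (Fin n → X) → ℝ≥0∞) (hg : Measurable g) (hh : Measurable h) :
    mixG μ n p (fun x => g x + h x) ≤ mixG μ n p g + mixG μ n p h := by
  induction n with
  | zero => exact le_rfl
  | succ n ih =>
    have key : ∀ g : (Fin (n + 1) → X) → ℝ≥0∞, Measurable g →
        Measurable (fun q : X × (Fin n → X) => g (Fin.snoc q.2 q.1)) := fun g hg =>
      hg.comp ((measurable_snoc n).comp (measurable_snd.prodMk measurable_fst))
    have key2 : ∀ g : (Fin (n + 1) → X) → ℝ≥0∞, Measurable g →
        ∀ t, Measurable (fun x : (Fin n → X) => g (Fin.snoc x t)) := fun g hg t =>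
      (key g hg).comp (measurable_const.prodMk measurable_id)
    simp only [mixG]
    refine le_trans (eLpNorm_mono_enorm (g := fun t =>
      mixG μ n (fun i => p i.castSucc) (fun x => g (Fin.snoc x t)) +
      mixG μ n (fun i => p i.castSucc) (fun x => h (Fin.snoc x t))) ?_) ?_
    · intro t
      exact ih _ (fun i => hp _) _ _ (key2 g hg t) (key2 h hh t)
    · refine eLpNorm_add_le ?_ ?_ (hp _)
      · exact (measurable_mixG μ n _ (fun t x => g (Fin.snoc x t)) (key g hg)).aestronglyMeasurable
      · exact (measurable_mixG μ n _ (fun t x => h (Fin.snoc x t)) (key h hh)).aestronglyMeasurable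

theorem mixG_sum [SFinite μ] (n : ℕ) (p : Fin n → ℝ≥0∞) (hp : ∀ i, 1 ≤ p i) {ι : Type}
    (J : Finset ι) (g : ι → (Fin n → X) → ℝ≥0∞) (hg : ∀ j, Measurable (g j)) :
    mixG μ n p (fun x => ∑ j ∈ J, g j x) ≤ ∑ j ∈ J, mixG μ n p (g j) := by
  classical
  induction J using Finset.induction_on with
  | empty => simp [mixG_zero]
  | insert a J ha ih =>
    simp only [Finset.sum_insert ha]
    refine (mixG_add μ n p hp _ _ (hg a) ?_).trans (add_le_add le_rfl ih)
    exact Finset.measurable_sum _ (fun j _ => hg j)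

end general

theorem mixG_map {X Y : Type} [MeasurableSpace X] [MeasurableSpace Y] [DiscreteMeasurableSpace Y]
    (μ : Measure X) (φ : X → Y) (hφ : Measurable φ) (n : ℕ) (p : Fin n → ℝ≥0∞)
    (b : (Fin n → Y) → ℝ≥0∞) :
    mixG μ n p (fun x => b (fun i => φ (x i))) = mixG (μ.map φ) n p b := by
  induction n with
  | zero => simp only [mixG]; congr 1; funext i; exact i.elim0
  | succ n ih =>
    simp only [mixG]
    rw [eLpNorm_map_measure (Measurable.of_discrete).aestronglyMeasurable hφ.aemeasurable]
    congr 1; funext t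
    simp only [Function.comp]
    rw [← ih]
    congr 1; funext x; congr 1
    exact (Fin.comp_snoc φ x t)

theorem mixG_inj (n : ℕ) (p : Fin n → ℝ≥0∞) (ψ : Fin n → ℤ → ℤ)
    (hψ : ∀ i, Function.Injective (ψ i)) (b : (Fin n → ℤ) → ℝ≥0∞) :
    mixG Measure.count n p (fun k => b (fun i => ψ i (k i))) ≤ mixG Measure.count n p b := by
  induction n with
  | zero => simp only [mixG]; apply le_of_eq; congr 1; funext i; exact i.elim0
  | succ n ih =>
    simp only [mixG]
    have hle : (Measure.count : Measure ℤ).map (ψ (Fin.last n)) ≤ Measure.count := by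
      rw [Measure.le_iff]
      intro s hs
      rw [Measure.map_apply (Measurable.of_discrete) hs, ← Measure.count_injective_image (hψ (Fin.last n))]
      exact measure_mono (image_preimage_subset _ _)
    refine le_trans ?_ (eLpNorm_mono_measure _ hle)
    rw [eLpNorm_map_measure (Measurable.of_discrete).aestronglyMeasurable
      (Measurable.of_discrete).aemeasurable]
    apply eLpNorm_mono_enorm
    intro t
    simp only [Function.comp, enorm_eq_self]
    refine le_trans (le_of_eq ?_) (ih _ (fun i => ψ i.castSucc) (fun i => hψ _) _)
    congr 1; funext x; congr 1; funext i
    refine Fin.lastCases ?_ (fun i => ?_) i <;> simp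

theorem mixG_congr_ae (n : ℕ) (p : Fin n → ℝ≥0∞) (g h : (Fin n → ℝ) → ℝ≥0∞)
    (hgh : g =ᵐ[volume] h) : mixG volume n p g = mixG volume n p h := by
  induction n with
  | zero =>
    simp only [mixG]
    have : ∀ᵐ x ∂(volume : Measure (Fin 0 → ℝ)), g x = h x := hgh
    rw [ae_iff] at this
    by_contra hne
    have h1 : {a | ¬ g a = h a} = univ := by
      ext a; simp only [mem_ofPred_eq, mem_univ, iff_true]
      rwa [Subsingleton.elim a Fin.elim0]
    rw [h1] at this
    simp [volume_pi] at this
  | succ n ih =>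
    simp only [mixG]
    apply eLpNorm_congr_ae
    have mp := (volume_preserving_piFinSuccAbove (fun _ : Fin (n + 1) => ℝ) (Fin.last n)).symm
    have h1 := mp.quasiMeasurePreserving.ae hgh
    have h2 := Measure.ae_ae_of_ae_prod h1
    filter_upwards [h2] with t ht
    apply ih
    filter_upwards [ht] with x hx
    simpa [MeasurableEquiv.piFinSuccAbove, Fin.insertNthEquiv, Fin.insertNth_last'] using hx

theorem map_floor (r : ℝ) (hr : 0 < r) :
    (volume : Measure ℝ).map (fun t => ⌊t / r⌋) = ENNReal.ofReal r • Measure.count := by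
  rw [Measure.ext_iff_singleton]
  intro k
  have hm : Measurable (fun t : ℝ => ⌊t / r⌋) := Int.measurable_floor.comp (measurable_id.div_const r)
  rw [Measure.map_apply hm (measurableSet_singleton k)]
  have : (fun t : ℝ => ⌊t / r⌋) ⁻¹' {k} = Ico (r * k) (r * (k + 1)) := by
    ext t
    simp only [mem_preimage, mem_singleton_iff, Int.floor_eq_iff, mem_Ico]
    rw [le_div_iff₀ hr, div_lt_iff₀ hr, mul_comm r, mul_comm r]
  rw [this, Real.volume_Ico]
  simp
  congr 1; ring

theorem mixG_step (n : ℕ) (s : Fin n → ℝ≥0∞) (r : ℝ) (hr : 0 < r) (b : (Fin n → ℤ) → ℝ≥0∞) :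
    mixG volume n s (fun y => b (fun i => ⌊y i / r⌋))
      = ENNReal.ofReal r ^ invSum n s * mixG Measure.count n s b := by
  have hm : Measurable (fun t : ℝ => ⌊t / r⌋) := Int.measurable_floor.comp (measurable_id.div_const r)
  rw [mixG_map volume (fun t : ℝ => ⌊t / r⌋) hm, map_floor r hr,
    mixG_smul _ _ _ _ (by simpa using hr) (by simp)]

theorem exists_rep (n : ℕ) (p : Fin n → ℝ≥0∞) (hp : ∀ i, 1 ≤ p i) (f : (Fin n → ℝ) → ℝ)
    (hf : AEStronglyMeasurable f volume) :
    ∃ g : (Fin n → ℝ) → ℝ≥0∞, Measurable g ∧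
      ∀ S : Set (Fin n → ℝ), mixedLp n p (S.indicator f) = mixG volume n p (S.indicator g) := by
  obtain ⟨f', hf', hff'⟩ := hf
  refine ⟨fun x => ‖f' x‖ₑ, hf'.measurable.enorm, fun S => ?_⟩
  rw [mixedLp, mixedE_eq _ _ (fun i => (lt_of_lt_of_le one_pos (hp i)).ne')]
  apply mixG_congr_ae
  filter_upwards [hff'] with x hx
  by_cases hxS : x ∈ S
  · simp [hxS, hx, enorm]
  · simp [hxS]

theorem measurableSet_qcube (n : ℕ) (r : ℝ) (k : Fin n → ℤ) : MeasurableSet (qcube n r k) := by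
  have : qcube n r k = ⋂ i, (fun x : Fin n → ℝ => x i) ⁻¹' Ico (r * k i) (r * (k i + 1)) := by
    ext x; simp [qcube]
  rw [this]
  exact MeasurableSet.iInter fun i => measurable_pi_apply i measurableSet_Ico

theorem cover_le (n : ℕ) (p : Fin n → ℝ≥0∞) (hp : ∀ i, 1 ≤ p i) (f : (Fin n → ℝ) → ℝ)
    (hf : AEStronglyMeasurable f volume) {ι : Type} [Fintype ι] (S : Set (Fin n → ℝ))
    (T : ι → Set (Fin n → ℝ)) (hT : ∀ j, MeasurableSet (T j)) (hS : ∀ x ∈ S, ∃ j, x ∈ T j) :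
    mixedLp n p (S.indicator f) ≤ ∑ j, mixedLp n p ((T j).indicator f) := by
  obtain ⟨g, hg, hgS⟩ := exists_rep n p hp f hf
  simp_rw [hgS]
  refine le_trans (mixG_mono volume n p (h := fun x => ∑ j, (T j).indicator g x) ?_)
    (mixG_sum volume n p hp Finset.univ (fun j => (T j).indicator g)
      (fun j => hg.indicator (hT j)))
  intro x
  by_cases hx : x ∈ S
  · obtain ⟨j, hj⟩ := hS x hx
    rw [indicator_of_mem hx]
    calc g x = (T j).indicator g x := by rw [indicator_of_mem hj]
      _ ≤ _ := Finset.single_le_sum (f := fun j => (T j).indicator g x)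
        (fun _ _ => bot_le) (Finset.mem_univ j)
  · simp [hx]

theorem mono_le (n : ℕ) (p : Fin n → ℝ≥0∞) (hp : ∀ i, 1 ≤ p i) (f : (Fin n → ℝ) → ℝ)
    {S T : Set (Fin n → ℝ)} (h : S ⊆ T) :
    mixedLp n p (S.indicator f) ≤ mixedLp n p (T.indicator f) := by
  have h0 := (fun i => (lt_of_lt_of_le one_pos (hp i)).ne')
  rw [mixedLp, mixedLp, mixedE_eq _ _ h0, mixedE_eq _ _ h0]
  apply mixG_mono
  intro x
  by_cases hx : x ∈ S
  · simp [hx, h hx]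
  · simp [hx]

theorem coord_lt {n : ℕ} {x y : Fin n → ℝ} {r : ℝ} (h : x ∈ eball n y r) (i : Fin n) :
    |x i - y i| < r := by
  refine lt_of_le_of_lt ?_ (show Real.sqrt (∑ i, (x i - y i) ^ 2) < r from h)
  rw [← Real.sqrt_sq_eq_abs]
  apply Real.sqrt_le_sqrt
  exact Finset.single_le_sum (f := fun i => (x i - y i) ^ 2) (fun _ _ => sq_nonneg _)
    (Finset.mem_univ i)

theorem upper_R (n : ℕ) (p s : Fin n → ℝ≥0∞) (hp : ∀ i, 1 ≤ p i) (hs : ∀ i, 1 ≤ s i)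
    (f : (Fin n → ℝ) → ℝ) (hf : AEStronglyMeasurable f volume) (r : ℝ) (hr : 0 < r) :
    amalgamNormR n p s r f ≤ (3 : ℝ≥0∞) ^ n * (ENNReal.ofReal r ^ invSum n s * discNormR n p s r f) := by
  have hs0 := (fun i => (lt_of_lt_of_le one_pos (hs i)).ne')
  rw [amalgamNormR, discNormR, mixedE_eq _ _ hs0, mixedSeq_eq _ _ hs0]
  set a : (Fin n → ℤ) → ℝ≥0∞ := fun k => mixedLp n p ((qcube n r k).indicator f) with ha
  have h1 : mixG volume n s (fun y => mixedLp n p ((eball n y r).indicator f)) ≤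
      mixG volume n s (fun y => (fun k : Fin n → ℤ => ∑ j : Fin n → Fin 3,
        a (fun i => k i + ((j i : ℕ) - 1 : ℤ))) (fun i => ⌊y i / r⌋)) := by
    apply mixG_mono
    intro y
    refine cover_le n p hp f hf _ (fun j : Fin n → Fin 3 =>
      qcube n r (fun i => ⌊y i / r⌋ + ((j i : ℕ) - 1 : ℤ))) (fun j => measurableSet_qcube _ _ _) ?_
    intro x hx
    have hk : ∀ i, ∃ j : Fin 3, ⌊x i / r⌋ = ⌊y i / r⌋ + ((j : ℕ) - 1 : ℤ) := by
      intro i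
      have h1 := abs_lt.1 (coord_lt hx i)
      have hd : x i / r < y i / r + 1 := by
        rw [div_add_one hr.ne']; gcongr; linarith
      have hd2 : y i / r < x i / r + 1 := by
        rw [div_add_one hr.ne']; gcongr; linarith
      have e1 : ⌊x i / r⌋ ≤ ⌊y i / r⌋ + 1 := by
        rw [← Int.floor_add_one]; exact Int.floor_le_floor hd.le
      have e2 : ⌊y i / r⌋ ≤ ⌊x i / r⌋ + 1 := by
        rw [← Int.floor_add_one]; exact Int.floor_le_floor hd2.le
      refine ⟨⟨(⌊x i / r⌋ - ⌊y i / r⌋ + 1).toNat, by omega⟩, ?_⟩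
      simp only
      omega
    choose j hj using hk
    refine ⟨j, fun i => ?_⟩
    simp only
    rw [← hj i]
    constructor
    · rw [mul_comm, ← le_div_iff₀ hr]; exact Int.floor_le _
    · rw [mul_comm, ← div_lt_iff₀ hr]; exact Int.lt_floor_add_one _
  refine h1.trans ?_
  rw [mixG_step n s r hr (fun k : Fin n → ℤ => ∑ j : Fin n → Fin 3,
        a (fun i => k i + ((j i : ℕ) - 1 : ℤ))), mul_left_comm]
  gcongr
  refine (mixG_sum Measure.count n s hs Finset.univ _ (fun j => Measurable.of_discrete)).trans ?_
  calc _ ≤ ∑ j : Fin n → Fin 3, mixG Measure.count n s a := by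
        apply Finset.sum_le_sum
        intro j _
        exact mixG_inj n s (fun i k => k + ((j i : ℕ) - 1 : ℤ)) (fun i => add_left_injective _) a
    _ = _ := by simp

theorem lower_R (n : ℕ) (p s : Fin n → ℝ≥0∞) (hp : ∀ i, 1 ≤ p i) (hs : ∀ i, 1 ≤ s i)
    (f : (Fin n → ℝ) → ℝ) (hf : AEStronglyMeasurable f volume) (r : ℝ) (hr : 0 < r) :
    ENNReal.ofReal r ^ invSum n s * discNormR n p s r f ≤
      ((n + 1 : ℕ) : ℝ≥0∞) ^ invSum n s * ((n + 1 : ℕ) : ℝ≥0∞) ^ n * amalgamNormR n p s r f := by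
  have hs0 := (fun i => (lt_of_lt_of_le one_pos (hs i)).ne')
  rw [amalgamNormR, discNormR, mixedE_eq _ _ hs0, mixedSeq_eq _ _ hs0]
  obtain ⟨N, hN⟩ : ∃ N : ℕ, N = n + 1 := ⟨_, rfl⟩
  rw [← hN]
  have hN0 : (0 : ℝ) < N := by rw [hN]; positivity
  set ρ : ℝ := r / N with hρ
  have hρ0 : 0 < ρ := by positivity
  have hrρ : r = N * ρ := by rw [hρ]; field_simp
  set a : (Fin n → ℤ) → ℝ≥0∞ := fun k => mixedLp n p ((qcube n ρ k).indicator f) with ha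
  have hσ : 0 ≤ invSum n s := Finset.sum_nonneg fun _ _ => ENNReal.toReal_nonneg
  have h1 : ENNReal.ofReal ρ ^ invSum n s * mixG Measure.count n s a ≤
      mixG volume n s (fun y => mixedLp n p ((eball n y r).indicator f)) := by
    rw [← mixG_step n s ρ hρ0]
    apply mixG_mono
    intro y
    apply mono_le n p hp
    intro x hx
    have hc : ∀ i, (x i - y i) ^ 2 ≤ ρ ^ 2 := by
      intro i
      have h2 := hx i
      have h3 := Int.floor_le (y i / ρ)
      have h4 := Int.lt_floor_add_one (y i / ρ)
      rw [le_div_iff₀ hρ0] at h3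
      rw [div_lt_iff₀ hρ0] at h4
      apply sq_le_sq'
      all_goals nlinarith
    change Real.sqrt _ < r
    rw [Real.sqrt_lt' hr]
    calc ∑ i, (x i - y i) ^ 2 ≤ ∑ i : Fin n, ρ ^ 2 := Finset.sum_le_sum fun i _ => hc i
      _ = n * ρ ^ 2 := by simp
      _ < N ^ 2 * ρ ^ 2 := by
        gcongr
        rw [hN]; push_cast; nlinarith [(Nat.cast_nonneg n : (0 : ℝ) ≤ n)]
      _ = r ^ 2 := by rw [hrρ]; ring
  have h2 : mixG Measure.count n s (fun k => mixedLp n p ((qcube n r k).indicator f)) ≤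
      (N : ℝ≥0∞) ^ n * mixG Measure.count n s a := by
    have h3 : mixG Measure.count n s (fun k => mixedLp n p ((qcube n r k).indicator f)) ≤
        mixG Measure.count n s (fun k => ∑ j : Fin n → Fin N,
          a (fun i => (N : ℤ) * k i + ((j i : ℕ) : ℤ))) := by
      apply mixG_mono
      intro k
      refine cover_le n p hp f hf _ (fun j : Fin n → Fin N =>
        qcube n ρ (fun i => (N : ℤ) * k i + ((j i : ℕ) : ℤ))) (fun j => measurableSet_qcube _ _ _) ?_
      intro x hx
      have hk : ∀ i, ∃ j : Fin N, ⌊x i / ρ⌋ = (N : ℤ) * k i + ((j : ℕ) : ℤ) := by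
        intro i
        have h4 := hx i
        have e1 : (N : ℤ) * k i ≤ ⌊x i / ρ⌋ := by
          rw [Int.le_floor, le_div_iff₀ hρ0]
          push_cast
          rw [hrρ] at h4
          linarith [h4.1]
        have e2 : ⌊x i / ρ⌋ < (N : ℤ) * k i + N := by
          rw [Int.floor_lt, div_lt_iff₀ hρ0]
          push_cast
          rw [hrρ] at h4
          linarith [h4.2]
        refine ⟨⟨(⌊x i / ρ⌋ - (N : ℤ) * k i).toNat, by omega⟩, ?_⟩
        simp only
        omega
      choose j hj using hk
      refine ⟨j, fun i => ?_⟩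
      simp only
      rw [← hj i]
      constructor
      · rw [mul_comm, ← le_div_iff₀ hρ0]; exact Int.floor_le _
      · rw [mul_comm, ← div_lt_iff₀ hρ0]; exact Int.lt_floor_add_one _
    refine h3.trans ?_
    refine (mixG_sum Measure.count n s hs Finset.univ _ (fun j => Measurable.of_discrete)).trans ?_
    calc _ ≤ ∑ j : Fin n → Fin N, mixG Measure.count n s a := by
          apply Finset.sum_le_sum
          intro j _
          refine mixG_inj n s (fun i k => (N : ℤ) * k + ((j i : ℕ) : ℤ)) (fun i x y hxy => ?_) a
          have hNz : (N : ℤ) ≠ 0 := by omega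
          exact mul_left_cancel₀ hNz (add_right_cancel hxy)
      _ = _ := by simp
  calc _ ≤ ENNReal.ofReal r ^ invSum n s * ((N : ℝ≥0∞) ^ n * mixG Measure.count n s a) := by
        gcongr
    _ = (N : ℝ≥0∞) ^ invSum n s * (N : ℝ≥0∞) ^ n *
        (ENNReal.ofReal ρ ^ invSum n s * mixG Measure.count n s a) := by
        rw [hrρ, ENNReal.ofReal_mul hN0.le, ENNReal.mul_rpow_of_nonneg _ _ hσ]
        simp only [ENNReal.ofReal_natCast]
        ring
    _ ≤ _ := by gcongr

theorem vol_eball (n : ℕ) (hn : 1 ≤ n) : ∃ ω : ℝ≥0∞, ω ≠ 0 ∧ ω ≠ ∞ ∧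
    ∀ (y : Fin n → ℝ) (r : ℝ), volume (eball n y r) = ENNReal.ofReal r ^ n * ω := by
  have : Nonempty (Fin n) := ⟨⟨0, hn⟩⟩
  refine ⟨ENNReal.ofReal (√Real.pi ^ Fintype.card (Fin n) /
    Real.Gamma (Fintype.card (Fin n) / 2 + 1)), ?_, ENNReal.ofReal_ne_top, fun y r => ?_⟩
  · rw [Ne, ENNReal.ofReal_eq_zero, not_le]
    have := Real.Gamma_pos_of_pos (show (0 : ℝ) < (Fintype.card (Fin n) / 2 + 1) by positivity)
    positivity
  · have h := EuclideanSpace.volume_ball (Fin n) (WithLp.toLp 2 y) r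
    rw [Fintype.card_fin] at h ⊢
    rw [← h, ← (EuclideanSpace.volume_preserving_symm_measurableEquiv_toLp (Fin n)).measure_preimage_equiv]
    congr 1
    ext x
    simp [eball, EuclideanSpace.dist_eq, Real.dist_eq, sq_abs]

/-- The continuous and discrete mixed-norm amalgam norms are
equivalent, with constants independent of `f`; in particular
`(L^{p⃗},L^{s⃗}) = (L^{p⃗},ℓ^{s⃗})` and `(L^{p⃗},L^{s⃗})^α = (L^{p⃗},ℓ^{s⃗})^α`. -/
theorem statement6 (n : ℕ) (hn : 1 ≤ n) (p s : Fin n → ℝ≥0∞) (α : ℝ≥0∞)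
    (hp : ∀ i, 1 ≤ p i) (hs : ∀ i, 1 ≤ s i) (hα : 1 ≤ α)
    (hα1 : invSum n s / (n : ℝ) ≤ (1 / α).toReal)
    (hα2 : (1 / α).toReal ≤ invSum n p / (n : ℝ)) :
    ∃ c C : ℝ≥0∞, 0 < c ∧ c ≤ C ∧ C < ∞ ∧
      ∀ f : (Fin n → ℝ) → ℝ, LocallyIntegrable f volume →
        (c * discNorm n p s f ≤ amalgamNorm n p s f ∧
          amalgamNorm n p s f ≤ C * discNorm n p s f) ∧
        (c * discNormA n p s α f ≤ amalgamNormA n p s α f ∧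
          amalgamNormA n p s α f ≤ C * discNormA n p s α f) := by
  have hs0 := (fun i => (lt_of_lt_of_le one_pos (hs i)).ne')
  obtain ⟨ω, hω0, hωt, hω⟩ := vol_eball n hn
  set e : ℝ := (1 / α).toReal - invSum n p / (n : ℝ) - invSum n s / (n : ℝ) with he
  set σ : ℝ := invSum n s with hσ
  set K1 : ℝ≥0∞ := (3 : ℝ≥0∞) ^ n with hK1
  set K2 : ℝ≥0∞ := ((n + 1 : ℕ) : ℝ≥0∞) ^ σ * ((n + 1 : ℕ) : ℝ≥0∞) ^ n with hK2
  have hK1t : K1 ≠ ∞ := by simp [hK1]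
  have hK2t : K2 ≠ ∞ := by
    refine ENNReal.mul_ne_top (ENNReal.rpow_ne_top_of_ne_zero (by simp) (by simp)) (by simp)
  have hK20 : K2 ≠ 0 := by
    refine mul_ne_zero ?_ (by simp)
    exact (ENNReal.rpow_pos (by simp) (by simp)).ne'
  have hwt : ω ^ e ≠ ∞ := ENNReal.rpow_ne_top_of_ne_zero hω0 hωt
  have hw0 : ω ^ e ≠ 0 := (ENNReal.rpow_pos (pos_iff_ne_zero.2 hω0) hωt).ne'
  refine ⟨min 1 (min K2⁻¹ (ω ^ e * K2⁻¹)), max 1 (max K1 (ω ^ e * K1)), ?_, ?_, ?_, ?_⟩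
  · simp only [lt_min_iff]
    refine ⟨one_pos, ENNReal.inv_pos.2 hK2t, ?_⟩
    exact pos_iff_ne_zero.2 (mul_ne_zero hw0 (ENNReal.inv_ne_zero.2 hK2t))
  · exact (min_le_left _ _).trans (le_max_left _ _)
  · simp only [max_lt_iff]
    exact ⟨ENNReal.one_lt_top, hK1t.lt_top, (ENNReal.mul_ne_top hwt hK1t).lt_top⟩
  intro f hf
  have hfm := hf.aestronglyMeasurable
  have U := upper_R n p s hp hs f hfm
  have L := lower_R n p s hp hs f hfm
  rw [← hσ] at U L
  rw [← hK2] at L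
  rw [← hK1] at U
  have L' : ∀ r : ℝ, 0 < r → K2⁻¹ * (ENNReal.ofReal r ^ σ * discNormR n p s r f) ≤
      amalgamNormR n p s r f := by
    intro r hr
    calc _ ≤ K2⁻¹ * (K2 * amalgamNormR n p s r f) := mul_le_mul_right (L r hr) _
      _ = _ := by rw [← mul_assoc, ENNReal.inv_mul_cancel hK20 hK2t, one_mul]
  refine ⟨⟨?_, ?_⟩, ?_, ?_⟩
  · refine le_trans ?_ (L' 1 one_pos)
    simp only [ENNReal.ofReal_one, ENNReal.one_rpow, one_mul]
    exact mul_le_mul_left ((min_le_right _ _).trans (min_le_left _ _)) _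
  · refine (U 1 one_pos).trans ?_
    simp only [ENNReal.ofReal_one, ENNReal.one_rpow, one_mul]
    exact mul_le_mul_left ((le_max_left _ _).trans (le_max_right _ _)) _
  all_goals
    have hterm : ∀ r : ℝ, 0 < r → mixedE n s (fun y =>
        volume (eball n y r) ^ e * mixedLp n p ((eball n y r).indicator f)) =
        ω ^ e * (ENNReal.ofReal r ^ ((n : ℝ) * e) * amalgamNormR n p s r f) := by
      intro r hr
      have hR0 : ENNReal.ofReal r ≠ 0 := by simpa using hr
      have hRt : ENNReal.ofReal r ≠ ∞ := ENNReal.ofReal_ne_top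
      have hv : (ENNReal.ofReal r ^ n * ω) ^ e = ω ^ e * ENNReal.ofReal r ^ ((n : ℝ) * e) := by
        rw [ENNReal.mul_rpow_of_ne_top (by simp) hωt, mul_comm, ENNReal.rpow_mul,
          ENNReal.rpow_natCast]
      simp_rw [hω, hv]
      rw [amalgamNormR, mixedE_eq _ _ hs0, mixedE_eq _ _ hs0, mixG_cmul, mul_assoc]
      exact ENNReal.mul_ne_top hwt (ENNReal.rpow_ne_top_of_ne_zero hR0 hRt)
    have hdisc : ∀ r : ℝ, 0 < r →
        ENNReal.ofReal (r ^ ((n : ℝ) * (1 / α).toReal - invSum n p)) * discNormR n p s r f =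
        ENNReal.ofReal r ^ ((n : ℝ) * e) * (ENNReal.ofReal r ^ σ * discNormR n p s r f) := by
      intro r hr
      have hR0 : ENNReal.ofReal r ≠ 0 := by simpa using hr
      have hRt : ENNReal.ofReal r ≠ ∞ := ENNReal.ofReal_ne_top
      rw [← mul_assoc, ← ENNReal.rpow_add _ _ hR0 hRt, ← ENNReal.ofReal_rpow_of_pos hr]
      congr 2
      have : (n : ℝ) ≠ 0 := by positivity
      rw [he]; field_simp; ring
  · rw [discNormA, amalgamNormA]
    simp only [ENNReal.mul_iSup]
    refine iSup₂_mono fun r hr => ?_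
    rw [hterm r hr, hdisc r hr]
    calc _ ≤ ω ^ e * K2⁻¹ * (ENNReal.ofReal r ^ ((n : ℝ) * e) *
            (ENNReal.ofReal r ^ σ * discNormR n p s r f)) :=
          mul_le_mul_left ((min_le_right _ _).trans (min_le_right _ _)) _
      _ = ω ^ e * (ENNReal.ofReal r ^ ((n : ℝ) * e) *
            (K2⁻¹ * (ENNReal.ofReal r ^ σ * discNormR n p s r f))) := by ring
      _ ≤ _ := by gcongr; exact L' r hr
  · rw [discNormA, amalgamNormA]
    simp only [ENNReal.mul_iSup]
    refine iSup₂_mono fun r hr => ?_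
    rw [hterm r hr, hdisc r hr]
    calc _ ≤ ω ^ e * (ENNReal.ofReal r ^ ((n : ℝ) * e) *
            (K1 * (ENNReal.ofReal r ^ σ * discNormR n p s r f))) := by gcongr; exact U r hr
      _ = ω ^ e * K1 * (ENNReal.ofReal r ^ ((n : ℝ) * e) *
            (ENNReal.ofReal r ^ σ * discNormR n p s r f)) := by ring
      _ ≤ _ := mul_le_mul_left ((le_max_right _ _).trans (le_max_right _ _)) _

end MixedAmalgam

end
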